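/- arXiv:2202.13787 — 6 statements merged into one kernel-verified Lean document; each statement's English description precedes it below -/
import Mathlib

section
/- π/4 = 83·arctan(1/107) + 17·arctan(1/1710) − 22·arctan(1/103697) − 24·arctan(1/2513489) − 44·arctan(1/18280007883) + 12·arctan(1/7939642926390344818) + 22·arctan(1/3054211727257704725384731479018). -/
open Real

/-- `HasAngle z θ` says that the Gaussian integer `z` is nonzero and that `θ` is one of the values
of its argument. -/
def HasAngle (z : GaussianInt) (θ : ℝ) : Prop :=
  ∃ r : ℝ, 0 < r ∧ (z.re : ℝ) = r * cos θ ∧ (z.im : ℝ) = r * sin θ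

namespace HasAngle

theorem mul {z w : GaussianInt} {θ φ : ℝ} (hz : HasAngle z θ) (hw : HasAngle w φ) :
    HasAngle (z * w) (θ + φ) := by
  obtain ⟨r, hr, hzre, hzim⟩ := hz
  obtain ⟨s, hs, hwre, hwim⟩ := hw
  refine ⟨r * s, mul_pos hr hs, ?_, ?_⟩
  · rw [Zsqrtd.re_mul, cos_add]
    push_cast
    rw [hzre, hzim, hwre, hwim]
    ring
  · rw [Zsqrtd.im_mul, sin_add]
    push_cast
    rw [hzre, hzim, hwre, hwim]
    ring

theorem pow {z : GaussianInt} {θ : ℝ} (hz : HasAngle z θ) (k : ℕ) :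
    HasAngle (z ^ k) (k * θ) := by
  induction k with
  | zero => exact ⟨1, one_pos, by simp, by simp⟩
  | succ k ih =>
    rw [pow_succ]
    convert ih.mul hz using 1
    push_cast
    ring

theorem star {z : GaussianInt} {θ : ℝ} (hz : HasAngle z θ) : HasAngle (star z) (-θ) := by
  obtain ⟨r, hr, hre, him⟩ := hz
  exact ⟨r, hr, by simp [hre], by simp [him]⟩

theorem arctan_one_div {n : ℤ} (hn : 0 < n) : HasAngle ⟨n, 1⟩ (arctan (1 / n)) := by
  have hn' : (0 : ℝ) < n := by exact_mod_cast hn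
  have hc := cos_arctan_pos (1 / n)
  refine ⟨n / cos (arctan (1 / n)), div_pos hn' hc, ?_, ?_⟩
  · rw [div_mul_cancel₀ _ hc.ne']
  · rw [div_mul_eq_mul_div, mul_div_assoc, ← tan_eq_sin_div_cos, tan_arctan,
      mul_one_div_cancel hn'.ne', Int.cast_one]

theorem eq_pi_div_four {z : GaussianInt} {θ : ℝ} (hz : HasAngle z θ) (h : z.re = z.im)
    (hθ : θ ∈ Set.Ioo (-(π / 2)) (π / 2)) : π / 4 = θ := by
  obtain ⟨r, hr, hre, him⟩ := hz
  have hc := cos_pos_of_mem_Ioo hθ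
  have hcs : cos θ = sin θ := by
    apply mul_left_cancel₀ hr.ne'
    rw [← hre, ← him, h]
  rw [← arctan_one]
  refine arctan_eq_of_tan_eq ?_ hθ
  rw [tan_eq_sin_div_cos, ← hcs, div_self hc.ne']

end HasAngle

theorem arctan_le_self_of_nonneg {x : ℝ} (hx : 0 ≤ x) : arctan x ≤ x := by
  simpa using le_tan (arctan_nonneg.2 hx) (arctan_lt_pi_div_two x)

theorem machin_like_seven_term_integer_reciprocals :
    π / 4 =
      83 * Real.arctan (1 / 107) + 17 * Real.arctan (1 / 1710)
        - 22 * Real.arctan (1 / 103697)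
        - 24 * Real.arctan (1 / 2513489)
        - 44 * Real.arctan (1 / 18280007883)
        + 12 * Real.arctan (1 / 7939642926390344818)
        + 22 * Real.arctan (1 / 3054211727257704725384731479018) := by
  have angle (n : ℤ) (hn : 0 < n) (k : ℕ) := (HasAngle.arctan_one_div hn).pow k
  have key := ((((((angle 107 (by norm_num) 83).mul (angle 1710 (by norm_num) 17)).mul
    (angle 103697 (by norm_num) 22).star).mul
    (angle 2513489 (by norm_num) 24).star).mul
    (angle 18280007883 (by norm_num) 44).star).mul
    (angle 7939642926390344818 (by norm_num) 12)).mul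
    (angle 3054211727257704725384731479018 (by norm_num) 22)
  simp only [← sub_eq_add_neg] at key
  push_cast at key
  refine key.eq_pi_div_four (by decide +kernel) ?_
  have bounds (x : ℝ) (hx : 0 ≤ x) : 0 ≤ arctan x ∧ arctan x ≤ x :=
    ⟨arctan_nonneg.2 hx, arctan_le_self_of_nonneg hx⟩
  have h₁ := bounds (1 / 107) (by norm_num)
  have h₂ := bounds (1 / 1710) (by norm_num)
  have h₃ := bounds (1 / 103697) (by norm_num)
  have h₄ := bounds (1 / 2513489) (by norm_num)
  have h₅ := bounds (1 / 18280007883) (by norm_num)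
  have h₆ := bounds (1 / 7939642926390344818) (by norm_num)
  have h₇ := bounds (1 / 3054211727257704725384731479018) (by norm_num)
  have hπ := pi_gt_three
  constructor <;> linarith
end

section
/- π/4 = 83·arctan(1/107) + 17·arctan(1/1710) − 22·arctan(1/103697) − 12·arctan(2/2513489) − 22·arctan(2/18280007883). -/
open Real

/-- The real number `θ` is an argument of the nonzero Gaussian integer `z`. -/
def GaussianInt.HasArg (z : GaussianInt) (θ : ℝ) : Prop :=
  ∃ r : ℝ, 0 < r ∧ (z : ℂ) = r * Complex.exp (θ * Complex.I)

namespace GaussianInt.HasArg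

variable {z w : GaussianInt} {θ φ : ℝ}

theorem mul (hz : z.HasArg θ) (hw : w.HasArg φ) : (z * w).HasArg (θ + φ) := by
  obtain ⟨r, hr, hz⟩ := hz
  obtain ⟨s, hs, hw⟩ := hw
  refine ⟨r * s, mul_pos hr hs, ?_⟩
  rw [map_mul, hz, hw]
  push_cast
  rw [add_mul, Complex.exp_add]
  ring

theorem pow (hz : z.HasArg θ) (n : ℕ) : (z ^ n).HasArg (n * θ) := by
  obtain ⟨r, hr, hz⟩ := hz
  refine ⟨r ^ n, pow_pos hr n, ?_⟩
  rw [map_pow, hz, mul_pow, ← Complex.exp_nat_mul]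
  push_cast
  rw [mul_assoc]

theorem star (hz : z.HasArg θ) : (Star.star z).HasArg (-θ) := by
  obtain ⟨r, hr, hz⟩ := hz
  refine ⟨r, hr, ?_⟩
  rw [GaussianInt.toComplex_star, hz, map_mul, ← Complex.exp_conj]
  simp

theorem arctan {a b : ℤ} (ha : 0 < a) :
    HasArg ⟨a, b⟩ (Real.arctan (b / a)) := by
  have ha' : (0 : ℝ) < a := by exact_mod_cast ha
  have hs : 0 < √(1 + (b / a : ℝ) ^ 2) := by positivity
  refine ⟨a * √(1 + (b / a : ℝ) ^ 2), mul_pos ha' hs, ?_⟩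
  rw [Complex.exp_mul_I, ← Complex.ofReal_cos, ← Complex.ofReal_sin, Real.cos_arctan,
    Real.sin_arctan]
  apply Complex.ext
  · simp only [GaussianInt.toComplex_def₂, Complex.re_ofReal_mul]
    simp
    field_simp
  · simp only [GaussianInt.toComplex_def₂, Complex.im_ofReal_mul]
    simp
    field_simp

theorem sin_eq_cos (hz : z.HasArg θ) (h : z.re = z.im) : sin θ = cos θ := by
  obtain ⟨r, hr, hz⟩ := hz
  have hre := congrArg Complex.re hz
  have him := congrArg Complex.im hz
  rw [Complex.re_ofReal_mul, Complex.exp_ofReal_mul_I_re, ← GaussianInt.intCast_re] at hre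
  rw [Complex.im_ofReal_mul, Complex.exp_ofReal_mul_I_im, ← GaussianInt.intCast_im] at him
  rw [h, him] at hre
  exact mul_left_cancel₀ hr.ne' hre

end GaussianInt.HasArg

theorem eq_pi_div_four_of_sin_eq_cos {θ : ℝ} (h₁ : -(π / 2) < θ) (h₂ : θ < π / 2)
    (h : sin θ = cos θ) : θ = π / 4 := by
  rw [← arctan_tan h₁ h₂, tan_eq_sin_div_cos, h,
    div_self (cos_pos_of_mem_Ioo ⟨h₁, h₂⟩).ne', arctan_one]

theorem arctan_lt_self_of_pos {x : ℝ} (hx : 0 < x) : Real.arctan x < x := by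
  simpa [Real.tan_arctan] using
    Real.lt_tan (Real.arctan_pos.2 hx) (Real.arctan_lt_pi_div_two x)

theorem wetherfield_five_term :
    π / 4 =
      83 * Real.arctan (1 / 107) + 17 * Real.arctan (1 / 1710)
        - 22 * Real.arctan (1 / 103697)
        - 12 * Real.arctan (2 / 2513489)
        - 22 * Real.arctan (2 / 18280007883) := by
  have harg (a b : ℤ) (ha : 0 < a) (n : ℕ) := (GaussianInt.HasArg.arctan (b := b) ha).pow n
  have key := ((((harg 107 1 (by norm_num) 83).mul (harg 1710 1 (by norm_num) 17)).mul
    (harg 103697 1 (by norm_num) 22).star).mul (harg 2513489 2 (by norm_num) 12).star).mul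
    (harg 18280007883 2 (by norm_num) 22).star |>.sin_eq_cos (by decide +kernel)
  push_cast at key
  simp only [← sub_eq_add_neg] at key
  have bounds {x : ℝ} (hx : 0 < x) : 0 < Real.arctan x ∧ Real.arctan x < x :=
    ⟨Real.arctan_pos.2 hx, arctan_lt_self_of_pos hx⟩
  have h₁ := bounds (x := 1 / 107) (by norm_num)
  have h₂ := bounds (x := 1 / 1710) (by norm_num)
  have h₃ := bounds (x := 1 / 103697) (by norm_num)
  have h₄ := bounds (x := 2 / 2513489) (by norm_num)
  have h₅ := bounds (x := 2 / 18280007883) (by norm_num)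
  have hpi := Real.pi_gt_three
  exact (eq_pi_div_four_of_sin_eq_cos (by linarith) (by linarith) key).symm
end

section
/- π/4 = 8·arctan(1/10) − arctan(1/84) − arctan(1/21342) − arctan(1/991268848) − arctan(1/193018008592515208050) − arctan(1/197967899896401851763240424238758988350338) − arctan(1/117573868168175352930277752844194126767991915008537018836932014293678271636885792397). -/
open Real

/-- Subtraction formula for `arctan`. -/
theorem Real.arctan_sub_of_neg_one_lt_mul {x y : ℝ} (h : -1 < x * y) :
    arctan x - arctan y = arctan ((x - y) / (1 + x * y)) := by
  rw [sub_eq_add_neg, ← arctan_neg, arctan_add (by linarith)]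
  congr 1
  ring

theorem Real.eight_mul_arctan_one_div_ten :
    8 * arctan (1 / 10) = arctan (74455920 / 72697201) := by
  rw [show 8 * arctan (1 / 10) = 2 * (2 * (2 * arctan (1 / 10))) by ring]
  iterate 3 rw [two_mul_arctan (by norm_num) (by norm_num)]
  norm_num

theorem machin_like_seven_term_iterated :
    π / 4 =
      8 * Real.arctan (1 / 10)
        - Real.arctan (1 / 84)
        - Real.arctan (1 / 21342)
        - Real.arctan (1 / 991268848)
        - Real.arctan (1 / 193018008592515208050)
        - Real.arctan (1 / 197967899896401851763240424238758988350338)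
        - Real.arctan (1 / 117573868168175352930277752844194126767991915008537018836932014293678271636885792397) := by
  rw [Real.eight_mul_arctan_one_div_ten, ← arctan_one]
  iterate 6 rw [Real.arctan_sub_of_neg_one_lt_mul (by norm_num)]
  norm_num
end

section
/- Let the sequence of rational numbers (B_m) be defined by B_1 = −14717113539487181/715391356779 and B_m = (1 + ⌊B_{m−1}⌋·B_{m−1})/(⌊B_{m−1}⌋ − B_{m−1}) for m ≥ 2. Then π/4 = 8·arctan(1/10) − arctan(1/100) − 2·arctan(1/1000) − Σ_{m=1}^{18} arctan(1/⌊B_m⌋). -/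
open Real

/-- One step of the greedy expansion of `arctan (1 / x)`. -/
def arctanStep (x : ℚ) : ℚ := (1 + (⌊x⌋ : ℚ) * x) / ((⌊x⌋ : ℚ) - x)

/-- If `x = n / d` with `n ≡ a` modulo `d * ds.prod`, then the iterates of `arctanStep` at `x`
have the denominators `ds`, the last iterate being an integer. Working with residues avoids the
numerators, whose size doubles at every step. -/
def HasDenominators : ℤ → ℤ → List ℤ → Prop
  | a, d, [] => a % d = 0
  | a, d, d' :: ds => a % d = d' ∧ 0 < d' ∧
      HasDenominators (-(d + a / d * a) % (d' :: ds).prod) d' ds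

lemma arctanStep_neg {x : ℚ} (hx : x < 0) (hfl : (⌊x⌋ : ℚ) ≠ x) : arctanStep x < 0 := by
  have hlt : (⌊x⌋ : ℚ) < x := lt_of_le_of_ne (Int.floor_le x) hfl
  exact div_neg_of_pos_of_neg (by nlinarith) (by linarith)

lemma arctan_one_div_eq_add_arctanStep {x : ℚ} (hx : x < 0) (hfl : (⌊x⌋ : ℚ) ≠ x) :
    arctan (1 / (x : ℝ)) = arctan (1 / (⌊x⌋ : ℝ)) + arctan (1 / (arctanStep x : ℝ)) := by
  have hlt : (⌊x⌋ : ℝ) < x := by exact_mod_cast lt_of_le_of_ne (Int.floor_le x) hfl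
  have hx' : (x : ℝ) < 0 := by exact_mod_cast hx
  have hf : (⌊x⌋ : ℝ) < 0 := hlt.trans hx'
  have hpos : 0 < (⌊x⌋ : ℝ) * x := mul_pos_of_neg_of_neg hf hx'
  have hprod : 1 / (x : ℝ) * -(1 / (⌊x⌋ : ℝ)) < 1 := by
    have : 0 < 1 / ((⌊x⌋ : ℝ) * x) := by positivity
    have e : 1 / (x : ℝ) * -(1 / (⌊x⌋ : ℝ)) = -(1 / ((⌊x⌋ : ℝ) * x)) := by
      field_simp
    linarith
  have key := arctan_add hprod
  rw [arctan_neg] at key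
  have e : 1 / (arctanStep x : ℝ) =
      (1 / (x : ℝ) + -(1 / (⌊x⌋ : ℝ))) / (1 - 1 / (x : ℝ) * -(1 / (⌊x⌋ : ℝ))) := by
    have h0 : (⌊x⌋ : ℝ) - x ≠ 0 := (sub_neg.2 hlt).ne
    have h1 : 1 + (⌊x⌋ : ℝ) * x ≠ 0 := by positivity
    have h2 : (x : ℝ) * ⌊x⌋ + 1 ≠ 0 := by linarith
    have hf' := hf.ne
    have hx'' := hx'.ne
    have h3 : 1 - 1 / (x : ℝ) * -(1 / (⌊x⌋ : ℝ)) = (1 + ⌊x⌋ * x) / (⌊x⌋ * x) := by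
      field_simp
      ring
    rw [h3, arctanStep]
    push_cast
    field_simp
    ring
  rw [e, ← key]
  ring

lemma arctanStep_intCast_div (n : ℤ) {d : ℤ} (hd : 0 < d) :
    arctanStep (n / d : ℚ) = ((-(d + n / d * n) : ℤ) : ℚ) / ((n % d : ℤ) : ℚ) := by
  have hd' : (d : ℚ) ≠ 0 := by exact_mod_cast hd.ne'
  have hfl : ⌊(n / d : ℚ)⌋ = n / d := by
    lift d to ℕ using hd.le
    exact Rat.floor_intCast_div_natCast n d
  have hden : ((n / d : ℤ) : ℚ) - n / d = -((n % d : ℤ) : ℚ) / d := by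
    have := Int.emod_add_mul_ediv n d
    have h : (n : ℚ) = ((n % d : ℤ) : ℚ) + d * ((n / d : ℤ) : ℚ) := by exact_mod_cast this.symm
    rw [eq_div_iff hd', sub_mul, div_mul_cancel₀ _ hd']
    linarith
  have hnum : 1 + ((n / d : ℤ) : ℚ) * (n / d) = (d + ((n / d : ℤ) : ℚ) * n) / d := by
    field_simp
  rw [arctanStep, hfl, hden, hnum, div_div_div_cancel_right₀ hd']
  push_cast
  rw [div_neg, neg_div]

lemma floor_intCast_div_ne {n d : ℤ} (hd : 0 < d) (h : n % d ≠ 0) :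
    (⌊(n / d : ℚ)⌋ : ℚ) ≠ n / d := by
  intro e
  rw [eq_div_iff (by exact_mod_cast hd.ne')] at e
  have e' : ⌊(n / d : ℚ)⌋ * d = n := by exact_mod_cast e
  exact h (Int.emod_eq_zero_of_dvd ⟨_, by rw [mul_comm]; exact e'.symm⟩)

theorem arctan_one_div_eq_sum_of_hasDenominators (ds : List ℤ) :
    ∀ (n a d : ℤ) (B : ℕ → ℚ), B 0 = n / d → B 0 < 0 → 0 < d →
      (∀ i, B (i + 1) = arctanStep (B i)) → n ≡ a [ZMOD d * ds.prod] →
      HasDenominators a d ds →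
      arctan (1 / (B 0 : ℝ)) = ∑ i ∈ Finset.range (ds.length + 1), arctan (1 / (⌊B i⌋ : ℝ)) := by
  induction ds with
  | nil =>
    intro n a d B h0 _ hd _ hmod hden
    have hdvd : d ∣ n := by
      refine Int.dvd_of_emod_eq_zero ?_
      rw [List.prod_nil, mul_one] at hmod
      exact Eq.trans hmod hden
    obtain ⟨k, rfl⟩ := hdvd
    have hk : B 0 = k := by
      have : (d : ℚ) ≠ 0 := by exact_mod_cast hd.ne'
      rw [h0]
      push_cast
      field_simp
    simp [hk]
  | cons d' ds ih =>
    intro n a d B h0 hneg hd hB hmod hden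
    obtain ⟨hr, hd', hden⟩ := hden
    have hnr : n % d = d' := Eq.trans (hmod.of_mul_right _) hr
    have hfl : (⌊B 0⌋ : ℚ) ≠ B 0 := by
      rw [h0]
      exact floor_intCast_div_ne hd (hnr ▸ hd'.ne')
    have hquot : n / d ≡ a / d [ZMOD (d' :: ds).prod] := by
      obtain ⟨k, hk⟩ := hmod.symm.dvd
      have : n = a + d * ((d' :: ds).prod * k) := by linarith
      rw [this, Int.add_mul_ediv_left _ _ hd.ne']
      simp [Int.ModEq]
    have hnum : -(d + n / d * n) ≡ -(d + a / d * a) % (d' :: ds).prod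
        [ZMOD (d' :: ds).prod] :=
      ((((hquot.mul (hmod.of_mul_left d)).add_left d).neg).trans (Int.mod_modEq _ _).symm)
    have hstep : B 1 = ((-(d + n / d * n) : ℤ) : ℚ) / (d' : ℚ) := by
      rw [hB 0, h0, arctanStep_intCast_div n hd, hnr]
    rw [arctan_one_div_eq_add_arctanStep hneg hfl, ← hB 0, List.length_cons,
      Finset.sum_range_succ', add_comm]
    congr 1
    exact ih _ _ d' (fun i ↦ B (i + 1)) hstep (by
      show B (0 + 1) < 0
      rw [hB 0]
      exact arctanStep_neg hneg hfl) hd' (fun i ↦ hB (i + 1)) hnum hden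

lemma pi_div_four_eq_arctan_decimal :
    π / 4 = 8 * arctan (1 / 10) - arctan (1 / 100) - 2 * arctan (1 / 1000)
      - arctan (1 / ((-14717113539487181 / 715391356779 : ℚ) : ℝ)) := by
  have e : 8 * arctan (1 / 10) = 2 * (2 * (2 * arctan (1 / 10))) := by ring
  rw [e, two_mul_arctan (by norm_num) (by norm_num), two_mul_arctan (by norm_num) (by norm_num),
    two_mul_arctan (by norm_num) (by norm_num), two_mul_arctan (by norm_num) (by norm_num)]
  simp only [sub_eq_add_neg (G := ℝ), ← arctan_neg]
  rw [arctan_add (by norm_num), arctan_add (by norm_num), arctan_add (by norm_num),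
    ← arctan_one]
  congr 1
  norm_num

theorem machin_like_21_term
    (B : ℕ → ℚ) (h1 : B 1 = -14717113539487181 / 715391356779)
    (hrec : ∀ m : ℕ, 2 ≤ m →
      B m = (1 + (⌊B (m - 1)⌋ : ℚ) * B (m - 1)) / ((⌊B (m - 1)⌋ : ℚ) - B (m - 1))) :
    π / 4 =
      8 * Real.arctan (1 / 10) - Real.arctan (1 / 100)
        - 2 * Real.arctan (1 / 1000)
        - ∑ m ∈ Finset.Icc 1 18, Real.arctan (1 / ((⌊B m⌋ : ℝ))) := by
  have hsum := arctan_one_div_eq_sum_of_hasDenominators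
    [632843527186, 102669193760, 69950370790, 49624331330, 38461877620, 16083111840, 5808773420,
      5158297980, 1612261520, 541831320, 419294440, 371068800, 193150000,
      122900000, 27150000, 4900000, 2500000]
    (-14717113539487181) (-14717113539487181) 715391356779 (fun i ↦ B (i + 1))
    (by simp [h1]) (by norm_num [h1]) (by norm_num) (fun i ↦ hrec (i + 2) (by omega))
    (Int.ModEq.refl _) (by norm_num [HasDenominators])
  rw [pi_div_four_eq_arctan_decimal, ← h1, hsum, ← Finset.Ico_add_one_right_eq_Icc,
    Finset.sum_Ico_eq_sum_range]
  simp [add_comm 1]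
end

section
/- For every positive integer n and every real number z with z < 0 or z ≥ 10^(−n) (i.e., z ∉ [0, 10^(−n))), arctan(1/z) = arctan(1/(⌊10^n·z⌋·10^(−n))) + arctan((⌊10^n·z⌋·10^(−n) − z)/(1 + z·⌊10^n·z⌋·10^(−n))). -/
open Real

theorem arctan_one_div_eq_add_of_mul_pos {z w : ℝ} (h : 0 < z * w) :
    arctan (1 / z) = arctan (1 / w) + arctan ((w - z) / (1 + z * w)) := by
  have key : arctan w - arctan z = arctan ((w - z) / (1 + z * w)) := by
    have hadd := arctan_add (x := w) (y := -z) (by linarith)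
    rwa [arctan_neg, ← sub_eq_add_neg, ← sub_eq_add_neg,
      show 1 - w * -z = 1 + z * w by ring] at hadd
  rw [← key, one_div, one_div]
  rcases mul_pos_iff.mp h with ⟨hz, hw⟩ | ⟨hz, hw⟩
  · rw [arctan_inv_of_pos hz, arctan_inv_of_pos hw]
    ring
  · rw [arctan_inv_of_neg hz, arctan_inv_of_neg hw]
    ring

theorem arctan_decimal_floor_split (n : ℕ) (hn : 0 < n) (z : ℝ)
    (hz : z < 0 ∨ (10 : ℝ) ^ (-(n : ℤ)) ≤ z) :
    Real.arctan (1 / z) =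
      Real.arctan (1 / ((⌊(10 : ℝ) ^ n * z⌋ : ℝ) * (10 : ℝ) ^ (-(n : ℤ)))) +
        Real.arctan (((⌊(10 : ℝ) ^ n * z⌋ : ℝ) * (10 : ℝ) ^ (-(n : ℤ)) - z) /
          (1 + z * ((⌊(10 : ℝ) ^ n * z⌋ : ℝ) * (10 : ℝ) ^ (-(n : ℤ))))) := by
  apply arctan_one_div_eq_add_of_mul_pos
  have hpow : (0 : ℝ) < 10 ^ n := by positivity
  have hinv : (0 : ℝ) < 10 ^ (-(n : ℤ)) := by positivity
  rcases hz with hz | hz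
  · have hfloor : (⌊(10 : ℝ) ^ n * z⌋ : ℝ) < 0 :=
      (Int.floor_le _).trans_lt (mul_neg_of_pos_of_neg hpow hz)
    exact mul_pos_of_neg_of_neg hz (mul_neg_of_neg_of_pos hfloor hinv)
  · have hone : (1 : ℝ) ≤ 10 ^ n * z := by
      rw [zpow_neg, zpow_natCast] at hz
      exact (inv_le_iff_one_le_mul₀' hpow).mp hz
    have hfloor : (0 : ℝ) < ⌊(10 : ℝ) ^ n * z⌋ :=
      Int.cast_pos.mpr (Int.floor_pos.mpr hone)
    exact mul_pos (hinv.trans_le hz) (mul_pos hfloor hinv)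
end

section
/- Let the sequence of rational numbers (B_m) be defined by B_1 = −147153121/1758719 and B_m = (1 + (⌊10²·B_{m−1}⌋·10^(−2))·B_{m−1})/((⌊10²·B_{m−1}⌋·10^(−2)) − B_{m−1}) for m ≥ 2. Then π/4 = 8·arctan(1/10) + Σ_{m=1}^{9} arctan(1/(⌊10²·B_m⌋·10^(−2))). -/
open Real

/-- One step `B ↦ (1 + qB) / (q - B)`, `q = ⌊100 B⌋ / 100`, for the fraction `B = p.1 / p.2`. -/
def roundStep (p : ℤ × ℤ) : ℤ × ℤ :=
  (-(100 * p.2 + 100 * p.1 / p.2 * p.1), 100 * p.1 % p.2)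

theorem floor_hundred_mul_div (a d : ℤ) (hd : 0 < d) :
    ⌊(10 : ℚ) ^ 2 * ((a : ℚ) / d)⌋ = 100 * a / d := by
  lift d to ℕ using hd.le
  rw [← Rat.floor_intCast_div_natCast]
  congr 1
  push_cast
  ring

theorem hundred_mul_ediv_neg {a d : ℤ} (ha : a < 0) (hd : 0 < d) : 100 * a / d < 0 :=
  Int.ediv_neg_of_neg_of_pos (by linarith) hd

theorem roundStep_fst_neg {p : ℤ × ℤ} (ha : p.1 < 0) (hd : 0 < p.2) : (roundStep p).1 < 0 := by
  have := mul_pos_of_neg_of_neg (hundred_mul_ediv_neg ha hd) ha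
  simp only [roundStep]
  linarith

theorem roundStep_div (p : ℤ × ℤ) (hd : 0 < p.2) :
    (((roundStep p).1 : ℚ) / (roundStep p).2) =
      (1 + ((⌊(10 : ℚ) ^ 2 * (p.1 / p.2)⌋ : ℚ) / 10 ^ 2) * (p.1 / p.2)) /
        (((⌊(10 : ℚ) ^ 2 * (p.1 / p.2)⌋ : ℚ) / 10 ^ 2) - p.1 / p.2) := by
  obtain ⟨a, d⟩ := p
  simp only [floor_hundred_mul_div a d hd, roundStep, Int.emod_def]
  have hd0 : (d : ℚ) ≠ 0 := by exact_mod_cast hd.ne'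
  generalize 100 * a / d = f
  have hnum : 1 + (f : ℚ) / 10 ^ 2 * (a / d) = (-(-(100 * d + f * a))) / (100 * d) := by
    field_simp
    ring
  have hden : (f : ℚ) / 10 ^ 2 - a / d = -(100 * a - d * f) / (100 * d) := by
    field_simp
    ring
  rw [hnum, hden, div_div_div_cancel_right₀ (by positivity), neg_div_neg_eq]
  push_cast
  rfl

theorem arctan_eq_add_arctan_roundStep {p : ℤ × ℤ} (ha : p.1 < 0) (hd : 0 < p.2) :
    arctan (p.2 / p.1) = arctan (1 / (((100 * p.1 / p.2 : ℤ) : ℝ) / 10 ^ 2)) +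
      arctan ((roundStep p).2 / (roundStep p).1) := by
  have hf := hundred_mul_ediv_neg ha hd
  have ha' := roundStep_fst_neg ha hd
  have hr := Int.emod_lt_of_pos (100 * p.1) hd
  obtain ⟨a, d⟩ := p
  simp only [roundStep, Int.emod_def] at *
  generalize 100 * a / d = f at *
  have hprod : 100 * (100 * a - d * f) < f * -(100 * d + f * a) := by
    nlinarith [mul_pos_of_neg_of_neg hf ha, mul_pos_of_neg_of_neg hf hf]
  have hfR : (f : ℝ) ≠ 0 := by exact_mod_cast hf.ne
  have haR : (a : ℝ) ≠ 0 := by exact_mod_cast ha.ne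
  have haR' : ((-(100 * d + f * a) : ℤ) : ℝ) ≠ 0 := by exact_mod_cast ha'.ne
  have hpos : (0 : ℝ) < f * (-(100 * d + f * a) : ℤ) := by
    exact_mod_cast mul_pos_of_neg_of_neg hf ha'
  have hprodR : (100 : ℝ) * (100 * a - d * f : ℤ) < f * (-(100 * d + f * a) : ℤ) := by
    exact_mod_cast hprod
  have heq : 1 / ((f : ℝ) / 10 ^ 2) * ((100 * a - d * f : ℤ) / (-(100 * d + f * a) : ℤ)) =
      100 * (100 * a - d * f : ℤ) / (f * (-(100 * d + f * a) : ℤ)) := by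
    field_simp
    push_cast
    ring
  have hlt : 1 / ((f : ℝ) / 10 ^ 2) * ((100 * a - d * f : ℤ) / (-(100 * d + f * a) : ℤ)) < 1 := by
    rw [heq, div_lt_one hpos]
    exact hprodR
  rw [arctan_add hlt]
  congr 1
  rw [eq_div_iff (sub_pos.mpr hlt).ne']
  push_cast at haR' ⊢
  generalize hc : (-(100 * d + f * a) : ℝ) = c at haR' ⊢
  field_simp
  rw [← hc]
  ring

theorem four_mul_arctan_one_div_ten : 4 * arctan (1 / 10) = arctan (3960 / 9401) := by
  have h : 2 * arctan (1 / 10) = arctan (20 / 99) := by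
    rw [two_mul_arctan (by norm_num) (by norm_num)]
    norm_num
  rw [show 4 * arctan (1 / 10) = 2 * (2 * arctan (1 / 10)) by ring, h,
    two_mul_arctan (by norm_num) (by norm_num)]
  norm_num

theorem pi_div_four_eq_eight_mul_arctan_add :
    π / 4 = 8 * arctan (1 / 10) + arctan (1758719 / -147153121) := by
  rw [show 8 * arctan (1 / 10) = 2 * (4 * arctan (1 / 10)) by ring, four_mul_arctan_one_div_ten,
    two_mul_arctan (by norm_num) (by norm_num), arctan_add (by norm_num), ← arctan_one]
  norm_num

theorem machin_like_10_term_decimal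
    (B : ℕ → ℚ) (h1 : B 1 = -147153121 / 1758719)
    (hrec : ∀ m : ℕ, 2 ≤ m →
      B m = (1 + ((⌊(10 : ℚ) ^ 2 * B (m - 1)⌋ : ℚ) / 10 ^ 2) * B (m - 1)) /
        (((⌊(10 : ℚ) ^ 2 * B (m - 1)⌋ : ℚ) / 10 ^ 2) - B (m - 1))) :
    π / 4 =
      8 * Real.arctan (1 / 10)
        + ∑ m ∈ Finset.Icc 1 9,
            Real.arctan (1 / (((⌊(10 : ℚ) ^ 2 * B m⌋ : ℝ)) / 10 ^ 2)) := by
  set s : ℕ → ℤ × ℤ := fun k ↦ roundStep^[k] (-147153121, 1758719) with hs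
  have s_succ (k : ℕ) : s (k + 1) = roundStep (s k) := Function.iterate_succ_apply' ..
  have s_zero : s 0 = (-147153121, 1758719) := rfl
  have s_pos : ∀ k < 9, 0 < (s k).2 := by
    intro k hk
    interval_cases k <;> norm_num [s_succ, s_zero, roundStep]
  have s_nine : (s 9).2 = 0 := by norm_num [s_succ, s_zero, roundStep]
  have s_neg : ∀ k < 9, (s k).1 < 0 := by
    intro k hk
    interval_cases k <;> norm_num [s_succ, s_zero, roundStep]
  have hB : ∀ k < 9, B (k + 1) = (s k).1 / (s k).2 := by
    intro k hk
    induction k with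
    | zero => simp [h1, hs]
    | succ k ih =>
      rw [hrec (k + 2) (by lia), s_succ, roundStep_div _ (s_pos k (by lia)), ← ih (by lia)]
      rfl
  have hsum : ∑ m ∈ Finset.Icc 1 9, arctan (1 / (((⌊(10 : ℚ) ^ 2 * B m⌋ : ℝ)) / 10 ^ 2)) =
      arctan ((s 0).2 / (s 0).1) - arctan ((s 9).2 / (s 9).1) := by
    rw [← Finset.sum_range_sub' (fun k ↦ arctan ((s k).2 / (s k).1)),
      ← Finset.Ico_add_one_right_eq_Icc, Finset.sum_Ico_eq_sum_range]
    refine Finset.sum_congr rfl fun k hk ↦ ?_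
    have hk9 : k < 9 := Finset.mem_range.mp hk
    rw [add_comm 1 k, hB k hk9, floor_hundred_mul_div _ _ (s_pos k hk9), s_succ,
      arctan_eq_add_arctan_roundStep (s_neg k hk9) (s_pos k hk9), add_sub_cancel_right]
  rw [hsum, s_nine, pi_div_four_eq_eight_mul_arctan_add]
  simp [hs]
end
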